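/- Let M = ℚ₂(ζ₇, √−2), a degree-6 extension of the 2-adic field ℚ₂ which is Galois over ℚ₂ with cyclic Galois group, and let E = ℚ₂(ζ₇) be its unramified cubic subfield. Let 𝒪_M and 𝒪_E be the rings of integers of M and E. Then there exists a group homomorphism χ: 𝒪_M^× → {1, −1} such that: (i) for every u ∈ 𝒪_E^×, χ(u) = 1 if and only if u is a norm from M, i.e. u ∈ N_{M/E}(M^×); and (ii) χ(τ(u)) = χ(u) for every τ ∈ Gal(M/ℚ₂) and every u ∈ 𝒪_M^×. -/

import Mathlib

theorem exists_char_of_not_mem {V : Type*} [CommGroup V] (P : Subgroup V)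
    (hsq : ∀ u : V, u ^ 2 ∈ P) (c : V) (hc : c ∉ P) :
    ∃ χ : V →* ℤˣ, (∀ u ∈ P, χ u = 1) ∧ χ c = -1 := by
  classical
  let : Module (ZMod 2) (Additive (V ⧸ P)) := AddCommGroup.zmodModule (by
    intro x
    induction x using Additive.rec with | _ y => 
    induction y using QuotientGroup.induction_on with | H u =>
    rw [← ofMul_pow, ← QuotientGroup.mk_pow, (QuotientGroup.eq_one_iff _).2 (hsq u)]
    rfl)
  have hne : Additive.ofMul (c : V ⧸ P) ≠ 0 := by
    intro h
    exact hc ((QuotientGroup.eq_one_iff _).1 (Additive.ofMul.injective h))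
  have : ∃ f : Module.Dual (ZMod 2) (Additive (V ⧸ P)), f (Additive.ofMul (c : V ⧸ P)) ≠ 0 := by
    by_contra! h
    exact hne ((Module.forall_dual_apply_eq_zero_iff (ZMod 2) _).1 h)
  obtain ⟨f, hf⟩ := this
  let e : ZMod 2 →+ Additive ℤˣ :=
    ZMod.lift 2 ⟨zmultiplesHom (Additive ℤˣ) (Additive.ofMul (-1)), by
      simp; rfl⟩
  have he : e 1 = Additive.ofMul (-1) := by
    have := ZMod.lift_coe 2 ⟨zmultiplesHom (Additive ℤˣ) (Additive.ofMul (-1)), by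
      simp; rfl⟩ 1
    simpa using this
  let g : (V ⧸ P) →* ℤˣ :=
    { toFun := fun x => (e (f (Additive.ofMul x))).toMul
      map_one' := by simp
      map_mul' := fun x y => by simp }
  refine ⟨g.comp (QuotientGroup.mk' P), ?_, ?_⟩
  · intro u hu
    have : (QuotientGroup.mk' P) u = 1 := (QuotientGroup.eq_one_iff _).2 hu
    rw [MonoidHom.comp_apply, this, map_one]
  · have h1 : f (Additive.ofMul (c : V ⧸ P)) = 1 := by
      generalize f (Additive.ofMul (c : V ⧸ P)) = z at hf
      revert z; decide
    change (e (f (Additive.ofMul (c : V ⧸ P)))).toMul = -1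
    rw [h1, he]; rfl

theorem exists_char {V : Type*} [CommGroup V] (G : V →* V) (hG : ∀ u, G (G (G (G (G (G u))))) = u)
    (c : V) (hc : G c = c)
    (hno : ∀ s v, G (G s) = s → G (G v) = v → c ^ 3 ≠ s ^ 2 * (v * G v)) :
    ∃ χ : V →* ℤˣ, (∀ u, χ (G u) = χ u) ∧ χ c = -1 := by
  let N : V → V := fun u => u * G (G u) * G (G (G (G u)))
  have hN1 : N 1 = 1 := by simp [N]
  have hNm : ∀ a b, N (a * b) = N a * N b := by
    intro a b; simp only [N, map_mul]; 
    simp only [mul_assoc, mul_left_comm, mul_comm]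
  have hNi : ∀ a, N a⁻¹ = (N a)⁻¹ := by
    intro a; simp only [N, map_inv, mul_inv]
  have hNG : ∀ a, N (G a) = G (N a) := by
    intro a; simp only [N, map_mul]
  have hNf : ∀ a, G (G (N a)) = N a := by
    intro a; simp only [N, map_mul, hG]
    simp only [mul_assoc, mul_left_comm, mul_comm]
  let P : Subgroup V :=
    { carrier := {u | ∃ s v, G (G s) = s ∧ G (G v) = v ∧ N u = s ^ 2 * (v * G v)}
      one_mem' := ⟨1, 1, by simp, by simp, by simp [hN1]⟩
      mul_mem' := by
        rintro a b ⟨s, v, hs, hv, h⟩ ⟨s', v', hs', hv', h'⟩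
        refine ⟨s * s', v * v', by simp [hs, hs'], by simp [hv, hv'], ?_⟩
        rw [hNm, h, h', map_mul, mul_pow]
        simp only [mul_assoc, mul_left_comm, mul_comm]
      inv_mem' := by
        rintro a ⟨s, v, hs, hv, h⟩
        refine ⟨s⁻¹, v⁻¹, by simp [hs], by simp [hv], ?_⟩
        rw [hNi, h, map_inv, mul_inv, mul_inv, inv_pow] }
  obtain ⟨χ, h1, h2⟩ := exists_char_of_not_mem P (fun u => ⟨N u, 1, hNf u, by simp, by
    rw [pow_two, hNm]; simp [pow_two]⟩) c (by
      rintro ⟨s, v, hs, hv, h⟩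
      refine hno s v hs hv ?_
      rw [← h]; simp [N, hc, pow_succ])
  refine ⟨χ, fun u => ?_, h2⟩
  have : G u * u⁻¹ ∈ P := by
    refine ⟨(N u)⁻¹, N u, by simp [hNf], hNf u, ?_⟩
    rw [hNm, hNi, hNG, pow_two]; group
    rw [mul_comm]
  have := h1 _ this
  rw [map_mul, map_inv, mul_inv_eq_one] at this
  exact this

theorem padic_norm_sq_ne (a b : ℚ_[2]) (ha : a ≠ 0) : ‖a ^ 2‖ ≠ ‖2 * b ^ 2‖ := by
  intro h
  by_cases hb : b = 0
  · subst hb; simp [ha] at h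
  rw [norm_mul, norm_pow, norm_pow, Padic.norm_eq_zpow_neg_valuation ha,
    Padic.norm_eq_zpow_neg_valuation hb] at h
  have h2 : ‖(2 : ℚ_[2])‖ = ((2 : ℕ) : ℝ) ^ (-1 : ℤ) := by
    have := Padic.norm_p (p := 2); simpa using this
  rw [h2, ← zpow_natCast, ← zpow_natCast, ← zpow_mul, ← zpow_mul, ← zpow_add₀ (by norm_num)] at h
  have := zpow_right_injective₀ (a := ((2 : ℕ) : ℝ)) (by norm_num) (by norm_num) h
  push_cast at this
  omega

theorem padic_ne_neg_two (a : ℚ_[2]) (b : ℚ_[2]) (ha : ‖a‖ = 1) : a ≠ -2 * b ^ 2 := by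
  intro h
  apply padic_norm_sq_ne 1 b one_ne_zero
  rw [h] at ha
  simpa using ha.symm

theorem padic_five (a b : ℚ_[2]) : a ^ 2 + 2 * b ^ 2 ≠ 5 := by
  intro h
  have h5 : ‖(5 : ℚ_[2])‖ ≤ 1 := PadicInt.norm_le_one (5 : ℤ_[2])
  have hab : ‖a‖ ≤ 1 ∧ ‖2 * b ^ 2‖ ≤ 1 := by
    by_cases ha : a = 0
    · subst ha; simp at h; rw [h]; simpa using h5
    have := Padic.add_eq_max_of_ne (padic_norm_sq_ne a b ha)
    rw [h] at this
    rw [this, max_le_iff] at h5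
    refine ⟨?_, h5.2⟩
    have := h5.1
    rw [norm_pow] at this
    exact (pow_le_one_iff_of_nonneg (norm_nonneg _) (by norm_num)).1 this
  have hb : ‖b‖ ≤ 1 := by
    by_contra! hb
    have hb0 : b ≠ 0 := by rintro rfl; simp at hb; linarith
    have h2 : ‖b‖ ≥ 2 := by
      rw [Padic.norm_eq_zpow_neg_valuation hb0] at hb ⊢
      have : (1:ℤ) ≤ -b.valuation := by
        by_contra! hh
        have := zpow_le_zpow_right₀ (a := ((2 : ℕ) : ℝ)) (by norm_num) (show -b.valuation ≤ 0 by omega)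
        rw [zpow_zero] at this
        linarith
      have := zpow_le_zpow_right₀ (a := ((2 : ℕ) : ℝ)) (by norm_num) this
      simpa using this
    have h3 := hab.2
    rw [norm_mul, norm_pow] at h3
    have h2' : ‖(2 : ℚ_[2])‖ = 2⁻¹ := by
      have := Padic.norm_p (p := 2); simpa using this
    rw [h2'] at h3
    nlinarith
  obtain ⟨a', ha'⟩ : ∃ a' : ℤ_[2], (a' : ℚ_[2]) = a := ⟨⟨a, hab.1⟩, rfl⟩
  obtain ⟨b', hb'⟩ : ∃ b' : ℤ_[2], (b' : ℚ_[2]) = b := ⟨⟨b, hb⟩, rfl⟩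
  have key : a' ^ 2 + 2 * b' ^ 2 = 5 := by
    apply Subtype.ext
    push_cast
    rw [ha', hb']
    exact h
  have := congrArg (PadicInt.toZModPow 3) key
  simp only [map_add, map_mul, map_pow, map_ofNat] at this
  revert this
  generalize PadicInt.toZModPow 3 a' = x
  generalize PadicInt.toZModPow 3 b' = y
  revert x y
  decide

theorem algebraMap_padic_two {R : Type*} [CommRing R] [Algebra ℤ_[2] R] :
    algebraMap ℤ_[2] R 2 = 2 := map_ofNat _ 2

open Polynomial in
theorem hensel_root {R : Type*} [CommRing R] (h : HenselianRing R (Ideal.span {(2 : R)}))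
    (e w : R) (a : R) (ha : ∃ r, a ^ 2 + e * a - w = 2 * r)
    (he : ∃ r, (2 * a + e) ^ 2 = 1 + 2 * r) :
    ∃ t, t ^ 2 + e * t = w ∧ ∃ r, t = a + 2 * r := by
  obtain ⟨r, hr⟩ := ha
  obtain ⟨q, hq⟩ := he
  obtain ⟨t, h1, h2⟩ := h.is_henselian (X ^ 2 + C e * X - C w) (by monicity!) a
    (by rw [Ideal.mem_span_singleton]; exact ⟨r, by simpa using hr⟩) (by
      apply IsUnit.of_mul_eq_one (Ideal.Quotient.mk _ (2 * a + e))
      rw [← map_mul, ← map_one (Ideal.Quotient.mk _), Ideal.Quotient.eq, Ideal.mem_span_singleton]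
      refine ⟨q, ?_⟩
      simp
      linear_combination hq)
  refine ⟨t, ?_, ?_⟩
  · simp [IsRoot.def] at h1; linear_combination h1
  · rw [Ideal.mem_span_singleton] at h2
    obtain ⟨r, hr⟩ := h2
    exact ⟨r, by linear_combination hr⟩

theorem isUnit_one_add_two {R : Type*} [CommRing R] (h : HenselianRing R (Ideal.span {(2 : R)}))
    (r : R) : IsUnit (1 + 2 * r) := by
  have := h.jac (Ideal.mem_span_singleton_self (2 : R))
  rw [Ideal.mem_jacobson_bot] at this
  simpa [add_comm] using this r

theorem norm_form {R : Type*} [CommRing R] (h : HenselianRing R (Ideal.span {(2 : R)}))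
    (hF : ∀ x : R, ∃ y r, x = y ^ 2 + 2 * r)
    (hAS : ∀ w : R, ∃ t r, w = t ^ 2 + t + 2 * r ∨ w = t ^ 2 + t + 1 + 2 * r)
    (u : R) (hu : IsUnit u) :
    ∃ a b, u = a ^ 2 + 2 * b ^ 2 ∨ u = 5 * (a ^ 2 + 2 * b ^ 2) := by
  have inv : ∀ r : R, ∃ s, (1 + 2 * r) * s = 1 := fun r => (isUnit_one_add_two h r).exists_right_inv
  have sq8 : ∀ w : R, ∃ q, q ^ 2 = 1 + 8 * w := by
    intro w
    obtain ⟨t, ht, -⟩ := hensel_root h 1 (2 * w) 0 ⟨-w, by ring⟩ ⟨0, by ring⟩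
    exact ⟨1 + 2 * t, by linear_combination 4 * ht⟩
  obtain ⟨x, r, hx⟩ := hF u
  obtain ⟨ui, hui⟩ := hu.exists_right_inv
  obtain ⟨s, hs⟩ := inv (-r * ui)
  have hxi : x ^ 2 * (ui * s) = 1 := by
    linear_combination (-ui * s) * hx + (1 + 2 * r * ui * 0) * hs + s * hui 
  obtain ⟨v, hv⟩ : ∃ v, u = x ^ 2 * (1 + 2 * v) := ⟨r * (ui * s), by
    linear_combination hx - 2 * r * hxi⟩
  obtain ⟨y, r₁, hy⟩ := hF v
  obtain ⟨s₁, hs₁⟩ := inv (y ^ 2)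
  obtain ⟨w, hw⟩ : ∃ w, 1 + 2 * v = (1 + 2 * y ^ 2) * (1 + 4 * w) := ⟨r₁ * s₁, by
    linear_combination 2 * hy - 4 * r₁ * hs₁⟩
  obtain ⟨t, r₂, ht⟩ := hAS w
  obtain ⟨s₂, hs₂⟩ := inv t
  rcases ht with ht | ht
  · obtain ⟨q, hq⟩ := sq8 (r₂ * s₂ ^ 2)
    refine ⟨x * (1 + 2 * t) * q, x * (1 + 2 * t) * q * y, Or.inl ?_⟩
    have h4 : 1 + 4 * w = (1 + 2 * t) ^ 2 * q ^ 2 := by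
      linear_combination 4 * ht - (1 + 2 * t) ^ 2 * hq - 8 * r₂ * ((1 + 2 * t) * s₂ + 1) * hs₂
    rw [hv, hw, h4]; ring
  · obtain ⟨s₅, hs₅⟩ := inv 2
    obtain ⟨q, hq⟩ := sq8 ((r₂ - 2 * (t ^ 2 + t)) * s₅ * s₂ ^ 2)
    refine ⟨x * (1 + 2 * t) * q, x * (1 + 2 * t) * q * y, Or.inr ?_⟩
    have h4 : 1 + 4 * w = 5 * ((1 + 2 * t) ^ 2 * q ^ 2) := by
      linear_combination 4 * ht - 5 * (1 + 2 * t) ^ 2 * hq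
        - 8 * (r₂ - 2 * (t ^ 2 + t)) * ((1 + 2 * t) ^ 2 * s₂ ^ 2) * hs₅
        - 8 * (r₂ - 2 * (t ^ 2 + t)) * ((1 + 2 * t) * s₂ + 1) * hs₂
    rw [hv, hw, h4]; ring

theorem adic_henselian {R : Type*} [CommRing R] [Algebra ℤ_[2] R] [Module.Finite ℤ_[2] R]
    [Module.Free ℤ_[2] R] : HenselianRing R (Ideal.span {(2 : R)}) := by
  let b := Module.Free.chooseBasis ℤ_[2] R
  have hmax : IsLocalRing.maximalIdeal ℤ_[2] = Ideal.span {2} := by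
    simpa using PadicInt.maximalIdeal_eq_span_p (p := 2)
  have key : ∀ (n : ℕ) (x : R), x ∈ (Ideal.span {(2 : R)} ^ n • ⊤ : Submodule R R) ↔
      ∀ i, b.repr x i ∈ (IsLocalRing.maximalIdeal ℤ_[2] ^ n • ⊤ : Submodule ℤ_[2] ℤ_[2]) := by
    intro n x
    have h2 : ∀ r : R, (2 : R) ^ n * r = (2 : ℤ_[2]) ^ n • r := by
      intro r; rw [Algebra.smul_def]; simp [algebraMap_padic_two]
    rw [hmax]
    simp only [← Ideal.one_eq_top, smul_eq_mul, mul_one, Ideal.span_singleton_pow,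
      Ideal.mem_span_singleton]
    constructor
    · rintro ⟨r, rfl⟩ i
      rw [h2, map_smul]
      exact ⟨b.repr r i, by simp⟩
    · intro h
      choose c hc using h
      refine ⟨b.equivFun.symm c, ?_⟩
      rw [h2]
      apply b.equivFun.injective
      ext i
      rw [map_smul, LinearEquiv.apply_symm_apply]
      simp [hc]
  have : IsAdicComplete (Ideal.span {(2 : R)}) R := 
    { haus' := by
        intro x hx
        apply b.repr.injective
        ext i
        rw [map_zero]
        refine IsHausdorff.haus (I := IsLocalRing.maximalIdeal ℤ_[2]) inferInstance _ fun n => ?_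
        have := hx n
        rw [SModEq.sub_mem, sub_zero, key] at this
        rw [SModEq.sub_mem, sub_zero]
        exact this i
      prec' := by
        intro f hf
        have : ∀ i, ∃ L, ∀ n, b.repr (f n) i ≡ L [SMOD (IsLocalRing.maximalIdeal ℤ_[2] ^ n • ⊤ : Submodule ℤ_[2] ℤ_[2])] := by
          intro i
          refine IsPrecomplete.prec (I := IsLocalRing.maximalIdeal ℤ_[2]) inferInstance ?_
          intro m n hmn
          have := hf hmn
          rw [SModEq.sub_mem, key] at this
          rw [SModEq.sub_mem]
          simpa using this i
        choose L hL using this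
        refine ⟨b.equivFun.symm L, fun n => ?_⟩
        rw [SModEq.sub_mem, key]
        intro i
        have := hL i n
        rw [SModEq.sub_mem] at this
        simpa [-Module.Basis.equivFun_symm_apply, ← Module.Basis.equivFun_apply] using this }
  infer_instance

theorem padicInt_two (a : ℤ_[2]) : ∃ b, a = 2 * b ∨ a = 1 + 2 * b := by
  have h : a - a.zmodRepr ∈ Ideal.span {((2 : ℕ) : ℤ_[2])} := by
    rw [← PadicInt.maximalIdeal_eq_span_p]
    exact PadicInt.sub_zmodRepr_mem a
  rw [Ideal.mem_span_singleton] at h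
  obtain ⟨b, hb⟩ := h
  have h2 := PadicInt.zmodRepr_lt_p a
  refine ⟨b, ?_⟩
  interval_cases h : a.zmodRepr
  · left; push_cast at hb; linear_combination hb
  · right; push_cast at hb; linear_combination hb

theorem frob_surj {R : Type*} [CommRing R] [Algebra ℤ_[2] R] (z : R) (hz : z ^ 7 = 1)
    (hgen : ∀ x : R, ∃ p : Polynomial ℤ_[2], Polynomial.aeval z p = x) (x : R) :
    ∃ y r, x = y ^ 2 + 2 * r := by
  obtain ⟨p, rfl⟩ := hgen x
  induction p using Polynomial.induction_on' with
  | add p q hp hq =>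
    obtain ⟨y, r, h⟩ := hp
    obtain ⟨y', r', h'⟩ := hq
    exact ⟨y + y', r + r' - y * y', by rw [map_add, h, h']; ring⟩
  | monomial n a =>
    rw [Polynomial.aeval_monomial]
    have hz8 : z ^ n = (z ^ (4 * n)) ^ 2 := by
      rw [← pow_mul, show 4 * n * 2 = 7 * n + n by ring, pow_add, pow_mul, hz]; simp
    obtain ⟨b, rfl | rfl⟩ := padicInt_two a
    · exact ⟨0, algebraMap _ R b * z ^ n, by simp [algebraMap_padic_two]; ring⟩
    · exact ⟨z ^ (4 * n), algebraMap _ R b * z ^ n, by rw [← hz8]; simp [algebraMap_padic_two]; ring⟩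

theorem pow_eight {R : Type*} [CommRing R] [Algebra ℤ_[2] R] (z : R) (hz : z ^ 7 = 1)
    (hgen : ∀ x : R, ∃ p : Polynomial ℤ_[2], Polynomial.aeval z p = x) (x : R) :
    ∃ r, x ^ 8 = x + 2 * r := by
  obtain ⟨p, rfl⟩ := hgen x
  induction p using Polynomial.induction_on' with
  | add p q hp hq =>
    obtain ⟨r, h⟩ := hp
    obtain ⟨r', h'⟩ := hq
    rw [map_add]
    generalize (Polynomial.aeval z) p = a at *
    generalize (Polynomial.aeval z) q = b at *
    refine ⟨r + r' + (4 * a ^ 7 * b + 14 * a ^ 6 * b ^ 2 + 28 * a ^ 5 * b ^ 3 + 35 * a ^ 4 * b ^ 4 +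
      28 * a ^ 3 * b ^ 5 + 14 * a ^ 2 * b ^ 6 + 4 * a * b ^ 7), ?_⟩
    linear_combination h + h'
  | monomial n a =>
    rw [Polynomial.aeval_monomial]
    have hz8 : (z ^ n) ^ 8 = z ^ n := by
      rw [← pow_mul, show n * 8 = 7 * n + n by ring, pow_add, pow_mul, hz]; simp
    have ha : ∃ c, a ^ 8 = a + 2 * c := by
      obtain ⟨b, rfl | rfl⟩ := padicInt_two a
      · exact ⟨128 * b ^ 8 - b, by ring⟩
      · exact ⟨128*b^8 + 512*b^7 + 896*b^6 + 896*b^5 + 560*b^4 + 224*b^3 + 56*b^2 + 7*b, by ring⟩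
    obtain ⟨c, hc⟩ := ha
    refine ⟨algebraMap _ R c * z ^ n, ?_⟩
    rw [mul_pow, hz8, ← map_pow, hc]; simp [algebraMap_padic_two]; ring

theorem exists_alpha : ∃ α : ℤ_[2], α ^ 2 + α + 2 = 0 := by
  obtain ⟨t, ht, -⟩ := hensel_root (adic_henselian (R := ℤ_[2])) 1 (-2) 0 ⟨1, by ring⟩ ⟨0, by ring⟩
  exact ⟨t, by linear_combination ht⟩

theorem theta_mem {R : Type*} [CommRing R] [IsDomain R] [Algebra ℤ_[2] R] (y : R)
    (hy : y ^ 7 = 1) (hy1 : y ≠ 1) :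
    ∃ β : ℤ_[2], β ^ 2 + β + 2 = 0 ∧ y + y ^ 2 + y ^ 4 = algebraMap _ R β := by
  have h0 : 1 + y + y ^ 2 + y ^ 3 + y ^ 4 + y ^ 5 + y ^ 6 = 0 := by
    have : (y - 1) * (1 + y + y ^ 2 + y ^ 3 + y ^ 4 + y ^ 5 + y ^ 6) = 0 := by
      linear_combination hy
    exact (mul_eq_zero.1 this).resolve_left (sub_ne_zero.2 hy1)
  obtain ⟨α, hα⟩ := exists_alpha
  have hα' : (algebraMap _ R α) ^ 2 + algebraMap _ R α + 2 = 0 := by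
    have := congrArg (algebraMap ℤ_[2] R) hα
    simpa [algebraMap_padic_two] using this
  have : (y + y ^ 2 + y ^ 4 - algebraMap _ R α) * (y + y ^ 2 + y ^ 4 + 1 + algebraMap _ R α) = 0 := by
    linear_combination 2 * h0 - hα' + y * hy
  rcases mul_eq_zero.1 this with h | h
  · exact ⟨α, hα, by linear_combination h⟩
  · exact ⟨-1 - α, by linear_combination hα, by simp; linear_combination h⟩

theorem artin_schreier {R : Type*} [CommRing R] [IsDomain R] [Algebra ℤ_[2] R] (z : R)
    (hz : z ^ 7 = 1)
    (hgen : ∀ x : R, ∃ p : Polynomial ℤ_[2], Polynomial.aeval z p = x) (w : R) :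
    ∃ t r, w = t ^ 2 + t + 2 * r ∨ w = t ^ 2 + t + 1 + 2 * r := by
  obtain ⟨p, rfl⟩ := hgen w
  induction p using Polynomial.induction_on' with
  | add p q hp hq =>
    obtain ⟨t, r, h⟩ := hp
    obtain ⟨t', r', h'⟩ := hq
    rw [map_add]
    rcases h with h | h <;> rcases h' with h' | h'
    · exact ⟨t + t', r + r' - t * t', Or.inl (by rw [h, h']; ring)⟩
    · exact ⟨t + t', r + r' - t * t', Or.inr (by rw [h, h']; ring)⟩
    · exact ⟨t + t', r + r' - t * t', Or.inr (by rw [h, h']; ring)⟩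
    · exact ⟨t + t', r + r' - t * t' + 1, Or.inl (by rw [h, h']; ring)⟩
  | monomial n a =>
    rw [Polynomial.aeval_monomial]
    have hy7 : (z ^ n) ^ 7 = 1 := by rw [← pow_mul, mul_comm, pow_mul, hz, one_pow]
    generalize z ^ n = y at *
    have hy : ∃ t r, y = t ^ 2 + t + 2 * r ∨ y = t ^ 2 + t + 1 + 2 * r := by
      by_cases hy1 : y = 1
      · exact ⟨0, 0, Or.inr (by rw [hy1]; ring)⟩
      · obtain ⟨β, -, hβ⟩ := theta_mem y hy7 hy1
        obtain ⟨γ, rfl | rfl⟩ := padicInt_two β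
        · refine ⟨y ^ 2, algebraMap _ R γ - (y ^ 4 + y ^ 2), Or.inl ?_⟩
          simp [algebraMap_padic_two] at hβ; linear_combination hβ
        · refine ⟨y ^ 2, algebraMap _ R γ - (y ^ 4 + y ^ 2), Or.inr ?_⟩
          simp [algebraMap_padic_two] at hβ; linear_combination hβ
    obtain ⟨b, rfl | rfl⟩ := padicInt_two a
    · exact ⟨0, algebraMap _ R b * y, by left; simp [algebraMap_padic_two]; ring⟩
    · obtain ⟨t, r, h⟩ := hy
      refine ⟨t, r + algebraMap _ R b * y, ?_⟩
      rcases h with h | h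
      · left; simp [algebraMap_padic_two]; linear_combination h
      · right; simp [algebraMap_padic_two]; linear_combination h

theorem unit_of_not_two {R : Type*} [CommRing R] [IsDomain R] [Algebra ℤ_[2] R]
    (h : HenselianRing R (Ideal.span {(2 : R)})) (z : R)
    (hz : z ^ 7 = 1)
    (hgen : ∀ x : R, ∃ p : Polynomial ℤ_[2], Polynomial.aeval z p = x) (x : R) :
    (∃ r, x = 2 * r) ∨ IsUnit x := by
  obtain ⟨r, hr⟩ := pow_eight z hz hgen x
  obtain ⟨e, he, q, hq⟩ := hensel_root h (-1) 0 (x ^ 7) ⟨x ^ 6 * r, by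
    linear_combination x ^ 6 * hr⟩ ⟨2 * x ^ 6 * (x + 2 * r)  - 2 * x ^ 7, by
    linear_combination 4 * x ^ 6 * hr⟩
  have : e * (e - 1) = 0 := by linear_combination he
  rcases mul_eq_zero.1 this with h0 | h1
  · left
    exact ⟨-q * x - r, by rw [h0] at hq; linear_combination -hr - x * hq⟩
  · right
    have : x * x ^ 6 = 1 + 2 * (-q) := by linear_combination h1 - hq
    exact isUnit_of_mul_isUnit_left (this ▸ isUnit_one_add_two h (-q))

theorem integral_of_spectral {M : Type*} [Field M] [Algebra ℚ_[2] M] [FiniteDimensional ℚ_[2] M]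
    [Algebra ℤ_[2] M] [IsScalarTower ℤ_[2] ℚ_[2] M] (y : M) :
    IsIntegral ℤ_[2] y ↔ spectralNorm ℚ_[2] M y ≤ 1 := by
  have hy : IsIntegral ℚ_[2] y := Algebra.IsIntegral.isIntegral y
  rw [spectralNorm, spectralValue_le_one_iff (minpoly.monic hy)]
  constructor
  · intro h n
    rw [minpoly.isIntegrallyClosed_eq_field_fractions' ℚ_[2] h, Polynomial.coeff_map]
    exact PadicInt.norm_le_one _
  · intro h
    have hl : minpoly ℚ_[2] y ∈ Polynomial.lifts (algebraMap ℤ_[2] ℚ_[2]) := by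
      rw [Polynomial.lifts_iff_coeff_lifts]
      intro n
      exact ⟨⟨_, h n⟩, rfl⟩
    obtain ⟨q, hq, -, hm⟩ := Polynomial.lifts_and_natDegree_eq_and_monic hl (minpoly.monic hy)
    refine ⟨q, hm, ?_⟩
    have := minpoly.aeval ℚ_[2] y
    rw [← hq, Polynomial.aeval_map_algebraMap] at this
    exact this

theorem integral_of_mul_conj {M : Type*} [Field M] [Algebra ℚ_[2] M] [FiniteDimensional ℚ_[2] M]
    [Algebra ℤ_[2] M] [IsScalarTower ℤ_[2] ℚ_[2] M] (τ : M ≃ₐ[ℚ_[2]] M) (y : M)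
    (h : IsIntegral ℤ_[2] (y * τ y)) : IsIntegral ℤ_[2] y := by
  rw [integral_of_spectral] at h ⊢
  have h1 := spectralAlgNorm_mul (K := ℚ_[2]) (L := M) y (τ y)
  rw [spectralAlgNorm_def, spectralAlgNorm_def, spectralAlgNorm_def,
    ← spectralNorm_eq_of_equiv τ y] at h1
  rw [h1] at h
  have := spectralNorm_nonneg (K := ℚ_[2]) y
  nlinarith

theorem exists_two_pow_mul (a : ℚ_[2]) : ∃ (n : ℕ) (b : ℤ_[2]), (b : ℚ_[2]) = 2 ^ n * a := by
  obtain ⟨n, hn⟩ := pow_unbounded_of_one_lt ‖a‖ (one_lt_two)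
  refine ⟨n, ⟨2 ^ n * a, ?_⟩, rfl⟩
  have h2' : ‖(2 : ℚ_[2])‖ = 2⁻¹ := by
    have := Padic.norm_p (p := 2); simpa using this
  rw [norm_mul, norm_pow, h2', inv_pow, inv_mul_le_iff₀ (by positivity)]
  linarith

theorem gen_adjoin {M : Type*} [Field M] [Algebra ℤ_[2] M] (ζ : M)
    (x : Algebra.adjoin ℤ_[2] {ζ}) : ∃ p : Polynomial ℤ_[2], Polynomial.aeval
      (⟨ζ, Algebra.self_mem_adjoin_singleton _ _⟩ : Algebra.adjoin ℤ_[2] {ζ}) p = x := by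
  obtain ⟨x, hx⟩ := x
  have hx' := hx
  rw [Algebra.adjoin_singleton_eq_range_aeval] at hx'
  obtain ⟨p, hp⟩ := hx'
  refine ⟨p, Subtype.ext ?_⟩
  exact (Polynomial.aeval_algHom_apply (Algebra.adjoin ℤ_[2] {ζ}).val _ p).symm.trans hp

theorem henselian_adjoin {M : Type*} [Field M] [Algebra ℚ_[2] M] 
    [Algebra ℤ_[2] M] [IsScalarTower ℤ_[2] ℚ_[2] M] (ζ : M) (hζ : ζ ^ 7 = 1) :
    HenselianRing (Algebra.adjoin ℤ_[2] {ζ}) (Ideal.span {2}) := by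
  have hint : IsIntegral ℤ_[2] ζ := IsIntegral.of_pow (n := 7) (by norm_num) (hζ ▸ isIntegral_one)
  have : Module.Finite ℤ_[2] (Algebra.adjoin ℤ_[2] {ζ}) :=
    Module.Finite.iff_fg.2 hint.fg_adjoin_singleton
  have hinj : Function.Injective (algebraMap ℤ_[2] M) := by
    rw [IsScalarTower.algebraMap_eq ℤ_[2] ℚ_[2] M]
    exact (algebraMap ℚ_[2] M).injective.comp (IsFractionRing.injective ℤ_[2] ℚ_[2])
  have : FaithfulSMul ℤ_[2] M := (faithfulSMul_iff_algebraMap_injective _ _).2 hinj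
  have : Module.IsTorsionFree ℤ_[2] M := inferInstance
  have : Module.IsTorsionFree ℤ_[2] (Algebra.adjoin ℤ_[2] {ζ}) := inferInstance
  have : Module.Free ℤ_[2] (Algebra.adjoin ℤ_[2] {ζ}) := inferInstance
  exact adic_henselian

theorem half_not_integral {M : Type*} [Field M] [Algebra ℚ_[2] M] 
    [Algebra ℤ_[2] M] [IsScalarTower ℤ_[2] ℚ_[2] M] (y : M) (hy : IsIntegral ℤ_[2] y) :
    2 * y ≠ 1 := by
  intro h
  have hy2 : y = algebraMap ℚ_[2] M (2⁻¹) := by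
    rw [map_inv₀, map_ofNat]; exact eq_inv_of_mul_eq_one_right h
  rw [hy2, isIntegral_algebraMap_iff (algebraMap ℚ_[2] M).injective] at hy
  obtain ⟨z, hz⟩ := IsIntegrallyClosed.isIntegral_iff.1 hy
  have h1 : ‖(2⁻¹ : ℚ_[2])‖ ≤ 1 := by rw [← hz]; exact PadicInt.norm_le_one z
  have h2' : ‖(2 : ℚ_[2])‖ = 2⁻¹ := by
    have := Padic.norm_p (p := 2); simpa using this
  rw [norm_inv, h2'] at h1
  norm_num at h1

theorem mem_adjoin_of_integral {M : Type*} [Field M] [Algebra ℚ_[2] M]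
    [FiniteDimensional ℚ_[2] M]
    [Algebra ℤ_[2] M] [IsScalarTower ℤ_[2] ℚ_[2] M] (ζ : M) (hζ : ζ ^ 7 = 1) (x : M)
    (hx : x ∈ IntermediateField.adjoin ℚ_[2] {ζ}) (hi : IsIntegral ℤ_[2] x) :
    x ∈ Algebra.adjoin ℤ_[2] {ζ} := by
  have h1 : ∃ n : ℕ, 2 ^ n * x ∈ Algebra.adjoin ℤ_[2] {ζ} := by
    have hx' : x ∈ Algebra.adjoin ℚ_[2] {ζ} := by
      rw [← IntermediateField.adjoin_simple_toSubalgebra_of_isAlgebraic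
        (Algebra.IsAlgebraic.isAlgebraic ζ)]
      exact hx
    rw [Algebra.adjoin_singleton_eq_range_aeval] at hx'
    obtain ⟨p, hp⟩ := hx'
    rw [← hp]
    clear hp hx hi
    have h2 : ∀ n : ℕ, (2 : M) ^ n ∈ Algebra.adjoin ℤ_[2] {ζ} := fun n =>
      pow_mem (by simp) n
    induction p using Polynomial.induction_on' with
    | add p q hp hq =>
      obtain ⟨m, hm⟩ := hp
      obtain ⟨n, hn⟩ := hq
      refine ⟨m + n, ?_⟩
      have := add_mem (mul_mem (h2 n) hm) (mul_mem (h2 m) hn)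
      convert this using 1
      rw [map_add]; simp only [AlgHom.toRingHom_eq_coe, RingHom.coe_coe]; ring
    | monomial k a =>
      obtain ⟨n, b, hb⟩ := exists_two_pow_mul a
      refine ⟨n, ?_⟩
      have h3 : (2 : M) ^ n * algebraMap ℚ_[2] M a = algebraMap ℤ_[2] M b := by
        rw [IsScalarTower.algebraMap_apply ℤ_[2] ℚ_[2] M]
        change _ = algebraMap ℚ_[2] M (b : ℚ_[2])
        rw [hb, map_mul, map_pow, map_ofNat]
      have := mul_mem (Subalgebra.algebraMap_mem (Algebra.adjoin ℤ_[2] {ζ}) b)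
        (pow_mem (Algebra.self_mem_adjoin_singleton ℤ_[2] ζ) k)
      rw [← h3] at this
      simpa [Polynomial.aeval_monomial, mul_assoc] using this
  obtain ⟨n, hn⟩ := h1
  induction n with
  | zero => simpa using hn
  | succ n ih =>
    apply ih
    have hi' : IsIntegral ℤ_[2] (2 ^ n * x) := by
      refine IsIntegral.mul (IsIntegral.pow ?_ n) hi
      rw [← algebraMap_padic_two]; exact isIntegral_algebraMap
    rw [pow_succ', mul_assoc] at hn
    generalize 2 ^ n * x = w at *
    rcases unit_of_not_two (henselian_adjoin ζ hζ) ⟨ζ, Algebra.self_mem_adjoin_singleton _ _⟩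
      (Subtype.ext hζ) (gen_adjoin ζ) ⟨2 * w, hn⟩ with ⟨r, hr⟩ | hu
    · have hr' : 2 * w = 2 * (r : M) := congrArg Subtype.val hr
      have h20 : (2 : M) ≠ 0 := by
        have : (algebraMap ℚ_[2] M) 2 ≠ 0 := by simp
        rwa [map_ofNat] at this
      rw [mul_left_cancel₀ h20 hr']
      exact r.2
    · exfalso
      obtain ⟨s, hs⟩ := hu.exists_right_inv
      have hs' : 2 * w * (s : M) = 1 := congrArg Subtype.val hs
      have hζi : IsIntegral ℤ_[2] ζ :=
        IsIntegral.of_pow (n := 7) (by norm_num) (hζ ▸ isIntegral_one)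
      have hsi : IsIntegral ℤ_[2] (s : M) :=
        Algebra.adjoin_le (S := integralClosure ℤ_[2] M) (Set.singleton_subset_iff.2 hζi) s.2
      exact half_not_integral (w * s) (hi'.mul hsi) (by rw [← mul_assoc]; exact hs')

theorem unit_form {M : Type*} [Field M] [Algebra ℚ_[2] M]
    [FiniteDimensional ℚ_[2] M]
    [Algebra ℤ_[2] M] [IsScalarTower ℤ_[2] ℚ_[2] M] (ζ : M) (hζ : ζ ^ 7 = 1) (x : M) (hx0 : x ≠ 0)
    (hx : x ∈ IntermediateField.adjoin ℚ_[2] {ζ}) (hi : IsIntegral ℤ_[2] x)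
    (hi' : IsIntegral ℤ_[2] x⁻¹) :
    ∃ a b : IntermediateField.adjoin ℚ_[2] {ζ}, x = (a : M) ^ 2 + 2 * (b : M) ^ 2 ∨
      x = 5 * ((a : M) ^ 2 + 2 * (b : M) ^ 2) := by
  have h1 := mem_adjoin_of_integral ζ hζ x hx hi
  have h2 := mem_adjoin_of_integral ζ hζ x⁻¹ (inv_mem hx) hi'
  have hu : IsUnit (⟨x, h1⟩ : Algebra.adjoin ℤ_[2] {ζ}) :=
    IsUnit.of_mul_eq_one ⟨x⁻¹, h2⟩ (Subtype.ext (mul_inv_cancel₀ hx0))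
  have hle : ∀ r : Algebra.adjoin ℤ_[2] {ζ}, (r : M) ∈ IntermediateField.adjoin ℚ_[2] {ζ} := by
    intro r
    have : Algebra.adjoin ℤ_[2] {ζ} ≤
        (IntermediateField.adjoin ℚ_[2] {ζ}).toSubalgebra.restrictScalars ℤ_[2] := by
      apply Algebra.adjoin_le
      simp
    exact this r.2
  have hg := gen_adjoin ζ
  obtain ⟨a, b, h⟩ := norm_form (henselian_adjoin ζ hζ)
    (frob_surj _ (Subtype.ext hζ) hg) (artin_schreier _ (Subtype.ext hζ) hg) _ hu
  refine ⟨⟨a, hle a⟩, ⟨b, hle b⟩, ?_⟩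
  rcases h with h | h
  · left; exact congrArg Subtype.val h
  · right; exact congrArg Subtype.val h

theorem norm_conj {M : Type*} [Field M] [Algebra ℚ_[2] M]
    (hdeg : Module.finrank ℚ_[2] M = 6) [IsGalois ℚ_[2] M]
    [Algebra ℤ_[2] M] [IsScalarTower ℤ_[2] ℚ_[2] M]
    (ζ : M) (hζ : IsPrimitiveRoot ζ 7) (η : M) (hη : η ^ 2 = -2)
    (hgen : IntermediateField.adjoin ℚ_[2] {ζ, η} = ⊤) :
    ∃ σ : M ≃ₐ[IntermediateField.adjoin ℚ_[2] {ζ}] M, σ η = -η ∧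
      ∀ y, algebraMap (↥(IntermediateField.adjoin ℚ_[2] {ζ})) M
        (Algebra.norm (↥(IntermediateField.adjoin ℚ_[2] {ζ})) y) = y * σ y := by
  classical
  have : FiniteDimensional ℚ_[2] M := Module.finite_of_finrank_pos (by omega)
  obtain ⟨β, -, hβ⟩ := theta_mem ζ hζ.pow_eq_one (hζ.ne_one (by norm_num))
  rw [IsScalarTower.algebraMap_apply ℤ_[2] ℚ_[2] M] at hβ
  generalize algebraMap ℤ_[2] ℚ_[2] β = θ at hβ
  have hE : Module.finrank ℚ_[2] (IntermediateField.adjoin ℚ_[2] {ζ}) ≤ 3 := by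
    rw [IntermediateField.adjoin.finrank (Algebra.IsIntegral.isIntegral ζ)]
    have hm : (Polynomial.X ^ 3 - Polynomial.C θ * Polynomial.X ^ 2
        - Polynomial.C (1 + θ) * Polynomial.X - 1 : Polynomial ℚ_[2]).Monic := by monicity!
    have hd : (Polynomial.X ^ 3 - Polynomial.C θ * Polynomial.X ^ 2
        - Polynomial.C (1 + θ) * Polynomial.X - 1 : Polynomial ℚ_[2]).natDegree = 3 := by
      compute_degree!
    rw [← hd]
    refine Polynomial.natDegree_le_of_dvd (minpoly.dvd _ _ ?_) hm.ne_zero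
    have h0 : 1 + ζ + ζ ^ 2 + ζ ^ 3 + ζ ^ 4 + ζ ^ 5 + ζ ^ 6 = 0 := by
      have := hζ.geom_sum_eq_zero (by norm_num)
      simp only [Finset.sum_range_succ, Finset.sum_range_zero] at this
      linear_combination this
    simp
    rw [← hβ]
    linear_combination -h0
  have hmul := Module.finrank_mul_finrank ℚ_[2] (IntermediateField.adjoin ℚ_[2] {ζ}) M
  have hcard := IsGalois.card_aut_eq_finrank (IntermediateField.adjoin ℚ_[2] {ζ}) M
  have h2 : 1 < Nat.card (M ≃ₐ[IntermediateField.adjoin ℚ_[2] {ζ}] M) := by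
    rw [hcard]; nlinarith
  have hext : ∀ σ τ : M ≃ₐ[IntermediateField.adjoin ℚ_[2] {ζ}] M, σ η = τ η → σ = τ := by
    intro σ τ h
    have hz : ∀ ρ : M ≃ₐ[IntermediateField.adjoin ℚ_[2] {ζ}] M, ρ ζ = ζ := fun ρ =>
      ρ.commutes ⟨ζ, IntermediateField.mem_adjoin_simple_self ℚ_[2] ζ⟩
    have : (σ.restrictScalars ℚ_[2]).toAlgHom = (τ.restrictScalars ℚ_[2]).toAlgHom := by
      have hle : IntermediateField.adjoin ℚ_[2] {ζ, η} ≤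
        { AlgHom.equalizer (σ.restrictScalars ℚ_[2]).toAlgHom (τ.restrictScalars ℚ_[2]).toAlgHom with
          inv_mem' := by
            intro x hx
            have hx' : σ x = τ x := hx
            change σ x⁻¹ = τ x⁻¹
            rw [map_inv₀, map_inv₀, hx'] } := by
        rw [IntermediateField.adjoin_le_iff]
        rintro x (rfl | rfl)
        · change σ x = τ x
          rw [hz, hz]
        · exact h
      rw [hgen] at hle
      ext x
      exact hle (IntermediateField.mem_top (x := x))
    ext x
    exact DFunLike.congr_fun this x
  have hpm : ∀ σ : M ≃ₐ[IntermediateField.adjoin ℚ_[2] {ζ}] M, σ η = η ∨ σ η = -η := by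
    intro σ
    apply sq_eq_sq_iff_eq_or_eq_neg.1
    rw [← map_pow, hη, map_neg, map_ofNat]
  rw [Finite.one_lt_card_iff_nontrivial] at h2
  obtain ⟨σ, hσ⟩ := exists_ne (1 : M ≃ₐ[IntermediateField.adjoin ℚ_[2] {ζ}] M)
  have hση : σ η = -η := (hpm σ).resolve_left fun h => hσ (hext _ _ h)
  refine ⟨σ, hση, fun y => ?_⟩
  rw [Algebra.norm_eq_prod_automorphisms]
  have huniv : (Finset.univ : Finset (M ≃ₐ[IntermediateField.adjoin ℚ_[2] {ζ}] M)) = {1, σ} := by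
    ext τ
    simp only [Finset.mem_univ, Finset.mem_insert, Finset.mem_singleton, true_iff]
    rcases hpm τ with h | h
    · left; exact hext _ _ h
    · right; exact hext _ _ (h.trans hση.symm)
  rw [huniv, Finset.prod_pair hσ.symm]
  rfl

theorem stmt_19 (M : Type*) [Field M] [Algebra ℚ_[2] M]
    (hdeg : Module.finrank ℚ_[2] M = 6) [IsGalois ℚ_[2] M]
    (hcyc : IsCyclic (M ≃ₐ[ℚ_[2]] M))
    [Algebra ℤ_[2] M] [IsScalarTower ℤ_[2] ℚ_[2] M]
    (ζ : M) (hζ : IsPrimitiveRoot ζ 7) (η : M) (hη : η ^ 2 = -2)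
    (hgen : IntermediateField.adjoin ℚ_[2] {ζ, η} = ⊤) :
    ∃ χ : (integralClosure ℤ_[2] M)ˣ →* ℤˣ,
      (∀ u : (integralClosure ℤ_[2] M)ˣ,
        ((u : integralClosure ℤ_[2] M) : M) ∈ IntermediateField.adjoin ℚ_[2] {ζ} →
        (χ u = 1 ↔ ∃ y : M, y ≠ 0 ∧
          algebraMap (↥(IntermediateField.adjoin ℚ_[2] {ζ})) M
              (Algebra.norm (↥(IntermediateField.adjoin ℚ_[2] {ζ})) y)
            = ((u : integralClosure ℤ_[2] M) : M))) ∧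
      (∀ (τ : M ≃ₐ[ℚ_[2]] M) (u v : (integralClosure ℤ_[2] M)ˣ),
        ((v : integralClosure ℤ_[2] M) : M) = τ ((u : integralClosure ℤ_[2] M) : M) →
        χ v = χ u) := by
  classical
  have : FiniteDimensional ℚ_[2] M := Module.finite_of_finrank_pos (by omega)
  have h20 : (2 : M) ≠ 0 := by
    have : (algebraMap ℚ_[2] M) 2 ≠ 0 := by simp
    rwa [map_ofNat] at this
  have hη0 : η ≠ 0 := by
    rintro rfl
    apply h20
    linear_combination hη
  have hext : ∀ u v : (integralClosure ℤ_[2] M)ˣ,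
      ((u : integralClosure ℤ_[2] M) : M) = v → u = v := fun u v h => Units.ext (Subtype.ext h)
  have hinv : ∀ u : (integralClosure ℤ_[2] M)ˣ,
      (((u⁻¹ : (integralClosure ℤ_[2] M)ˣ) : integralClosure ℤ_[2] M) : M) =
        ((u : integralClosure ℤ_[2] M) : M)⁻¹ := by
    intro u
    apply eq_inv_of_mul_eq_one_left
    exact congrArg Subtype.val u.inv_mul
  have hne : ∀ u : (integralClosure ℤ_[2] M)ˣ, ((u : integralClosure ℤ_[2] M) : M) ≠ 0 := by
    intro u h
    have : ((u : integralClosure ℤ_[2] M) : M) * ((u⁻¹ : (integralClosure ℤ_[2] M)ˣ) : integralClosure ℤ_[2] M) = 1 :=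
      congrArg Subtype.val u.mul_inv
    rw [h, zero_mul] at this
    exact zero_ne_one this
  have hmk : ∀ x : M, x ≠ 0 → IsIntegral ℤ_[2] x → IsIntegral ℤ_[2] x⁻¹ →
      ∃ u : (integralClosure ℤ_[2] M)ˣ, ((u : integralClosure ℤ_[2] M) : M) = x :=
    fun x h0 h1 h2 => ⟨⟨⟨x, h1⟩, ⟨x⁻¹, h2⟩, Subtype.ext (mul_inv_cancel₀ h0),
      Subtype.ext (inv_mul_cancel₀ h0)⟩, rfl⟩
  let act : (M ≃ₐ[ℚ_[2]] M) → (integralClosure ℤ_[2] M)ˣ →* (integralClosure ℤ_[2] M)ˣ :=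
    fun τ => Units.map ((τ.restrictScalars ℤ_[2]).mapIntegralClosure :
      integralClosure ℤ_[2] M →* integralClosure ℤ_[2] M)
  have hact : ∀ τ u, ((act τ u : integralClosure ℤ_[2] M) : M) =
      τ ((u : integralClosure ℤ_[2] M) : M) := fun τ u => rfl
  obtain ⟨g, hg⟩ := hcyc.exists_generator
  have hg6 : g ^ 6 = 1 := by
    rw [← hdeg, ← IsGalois.card_aut_eq_finrank]
    exact pow_card_eq_one'
  have hfix : ∀ x : M, g x = x → ∃ a : ℚ_[2], algebraMap ℚ_[2] M a = x := by
    intro x hx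
    have hall : ∀ τ : M ≃ₐ[ℚ_[2]] M, τ x = x := by
      intro τ
      have : Subgroup.zpowers g ≤ MulAction.stabilizer (M ≃ₐ[ℚ_[2]] M) x := by
        rw [Subgroup.zpowers_le]; exact hx
      exact this (hg τ)
    exact (IsGalois.mem_range_algebraMap_iff_fixed x).2 hall
  have hgη : g η = -η := by
    have : g η = η ∨ g η = -η := by
      apply sq_eq_sq_iff_eq_or_eq_neg.1
      rw [← map_pow, hη, map_neg, map_ofNat]
    refine this.resolve_left fun h => ?_
    obtain ⟨a, ha⟩ := hfix η h
    rw [← ha, ← map_pow, ← map_ofNat (algebraMap ℚ_[2] M) 2, ← map_neg] at hη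
    have h2 := (algebraMap ℚ_[2] M).injective hη
    refine padic_norm_sq_ne a 1 ?_ ?_
    · rintro rfl; simp at h2
    · rw [h2]; simp
  have hi5 : IsIntegral ℤ_[2] (5 : M) := by
    rw [← map_ofNat (algebraMap ℤ_[2] M) 5]; exact isIntegral_algebraMap
  have h5 : ∃ c : (integralClosure ℤ_[2] M)ˣ, ((c : integralClosure ℤ_[2] M) : M) = 5 := by
    have hu : IsUnit (5 : ℤ_[2]) := by
      have := isUnit_one_add_two (adic_henselian (R := ℤ_[2])) 2
      norm_num at this
      exact this
    obtain ⟨s, hs⟩ := hu.exists_right_inv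
    have hs' : (5 : M) * algebraMap ℤ_[2] M s = 1 := by
      rw [← map_ofNat (algebraMap ℤ_[2] M) 5, ← map_mul, hs, map_one]
    have h50 : (5 : M) ≠ 0 := left_ne_zero_of_mul_eq_one hs'
    refine hmk 5 h50 hi5 ?_
    rw [← eq_inv_of_mul_eq_one_right hs']
    exact isIntegral_algebraMap
  obtain ⟨c, hc⟩ := h5
  obtain ⟨χ, hχ, hχc⟩ := exists_char (act g) (by
      intro u
      apply hext
      simp only [hact]
      exact DFunLike.congr_fun hg6 _) c (hext _ _ (by rw [hact, hc, map_ofNat])) (by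
    intro s v hs hv h
    have hM : (5 : M) ^ 3 = ((s : integralClosure ℤ_[2] M) : M) ^ 2 *
        (((v : integralClosure ℤ_[2] M) : M) * g ((v : integralClosure ℤ_[2] M) : M)) := by
      rw [← hc, ← hact]
      exact congrArg (fun u : (integralClosure ℤ_[2] M)ˣ => ((u : integralClosure ℤ_[2] M) : M)) h
    have hs' : g (g ((s : integralClosure ℤ_[2] M) : M)) = s := by
      rw [← hact, ← hact, hs]
    have hv' : g (g ((v : integralClosure ℤ_[2] M) : M)) = v := by
      rw [← hact, ← hact, hv]
    have hs0 := hne s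
    have hv0 := hne v
    have hsint : IsIntegral ℤ_[2] (((s : integralClosure ℤ_[2] M) : M)) := s.1.2
    have hsint' : IsIntegral ℤ_[2] (((s : integralClosure ℤ_[2] M) : M))⁻¹ := by
      rw [← hinv]; exact (s⁻¹).1.2
    generalize ((s : integralClosure ℤ_[2] M) : M) = S at *
    generalize ((v : integralClosure ℤ_[2] M) : M) = W at *
    have hgW0 : g W ≠ 0 := by simpa using hv0
    have h50 : (5 : M) ≠ 0 := hc ▸ hne c
    have hgs : g S = S ∨ g S = -S := by
      apply sq_eq_sq_iff_eq_or_eq_neg.1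
      have := congrArg g hM
      rw [map_mul, map_mul, map_pow, map_pow, hv', map_ofNat, hM] at this
      have h3 : (S ^ 2 - g S ^ 2) * (W * g W) = 0 := by linear_combination this
      rcases mul_eq_zero.1 h3 with h3 | h3
      · linear_combination -h3
      · exact absurd h3 (mul_ne_zero hv0 hgW0)
    rcases hgs with hgs | hgs
    · skip
      obtain ⟨w, hw⟩ : ∃ w, w = S * W / 5 := ⟨_, rfl⟩
      have hw5 : w * g w = 5 := by
        rw [hw, map_div₀, map_mul, map_ofNat, hgs]
        field_simp
        linear_combination -hM
      have hgw : g (g w) = w := by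
        rw [hw]; simp only [map_div₀, map_mul, map_ofNat, hs', hv']
      obtain ⟨a, ha⟩ := hfix ((w + g w) / 2) (by
        rw [map_div₀, map_add, hgw, map_ofNat, add_comm])
      obtain ⟨b, hb⟩ := hfix ((w - g w) / (2 * η)) (by
        rw [map_div₀, map_sub, hgw, map_mul, hgη, map_ofNat]; field_simp; ring)
      apply padic_five a b
      apply (algebraMap ℚ_[2] M).injective
      rw [map_add, map_mul, map_pow, map_pow, ha, hb, map_ofNat, map_ofNat, ← hw5]
      rw [div_pow, div_pow, mul_pow, hη]
      field_simp
      ring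
    · obtain ⟨d, hd⟩ := hfix (S / η) (by rw [map_div₀, hgs, hgη]; field_simp)
      have hS : S ^ 2 = algebraMap ℚ_[2] M (-2 * d ^ 2) := by
        rw [map_mul, map_pow, hd, map_neg, map_ofNat, ← hη]; field_simp
      have key : ∀ q : ℚ_[2], IsIntegral ℤ_[2] (algebraMap ℚ_[2] M q) → ‖q‖ ≤ 1 := by
        intro q hq
        rw [isIntegral_algebraMap_iff (algebraMap ℚ_[2] M).injective] at hq
        obtain ⟨z, hz⟩ := IsIntegrallyClosed.isIntegral_iff.1 hq
        rw [← hz]; exact PadicInt.norm_le_one z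
      have k1 := key (-2 * d ^ 2) (hS ▸ hsint.pow 2)
      have k2 := key (-2 * d ^ 2)⁻¹ (by rw [map_inv₀, ← hS, ← inv_pow]; exact hsint'.pow 2)
      have hq0 : (-2 * d ^ 2) ≠ 0 := by
        intro h0
        rw [h0, map_zero] at hS
        exact hs0 (pow_eq_zero_iff (two_ne_zero)|>.1 hS)
      rw [norm_inv, inv_le_one₀ (norm_pos_iff.2 hq0)] at k2
      exact padic_ne_neg_two _ d (le_antisymm k1 k2) rfl)
  have hinvar : ∀ (τ : M ≃ₐ[ℚ_[2]] M) (u : (integralClosure ℤ_[2] M)ˣ), χ (act τ u) = χ u := by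
    intro τ
    let H : Subgroup (M ≃ₐ[ℚ_[2]] M) :=
      { carrier := {τ | ∀ u, χ (act τ u) = χ u}
        one_mem' := fun u => rfl
        mul_mem' := by
          intro a b ha hb u
          have : act (a * b) u = act a (act b u) := rfl
          rw [this, ha, hb]
        inv_mem' := by
          intro a ha u
          rw [← ha (act a⁻¹ u)]
          congr 1
          apply hext
          rw [hact, hact]
          exact a.apply_symm_apply _ }
    have : Subgroup.zpowers g ≤ H := by
      rw [Subgroup.zpowers_le]; exact hχ
    exact this (hg τ)
  have hinvar' : ∀ (τ : M ≃ₐ[ℚ_[2]] M) (u v : (integralClosure ℤ_[2] M)ˣ),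
        ((v : integralClosure ℤ_[2] M) : M) = τ ((u : integralClosure ℤ_[2] M) : M) →
        χ v = χ u := by
    intro τ u v h
    rw [hext v (act τ u) h, hinvar]
  refine ⟨χ, ?_, hinvar'⟩
  obtain ⟨σ, hση, hσ⟩ := norm_conj hdeg ζ hζ η hη hgen
  have hnorm : ∀ (u : (integralClosure ℤ_[2] M)ˣ) (y : M),
      y * σ y = ((u : integralClosure ℤ_[2] M) : M) → χ u = 1 := by
    intro u y hy
    have hy0 : y ≠ 0 := by
      rintro rfl
      exact hne u (by rw [← hy, zero_mul])
    have hi : IsIntegral ℤ_[2] y :=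
      integral_of_mul_conj (σ.restrictScalars ℚ_[2]) y (by
        change IsIntegral ℤ_[2] (y * σ y)
        rw [hy]; exact u.1.2)
    have hi' : IsIntegral ℤ_[2] y⁻¹ :=
      integral_of_mul_conj (σ.restrictScalars ℚ_[2]) y⁻¹ (by
        change IsIntegral ℤ_[2] (y⁻¹ * σ y⁻¹)
        rw [map_inv₀, ← mul_inv, hy, ← hinv]; exact (u⁻¹).1.2)
    obtain ⟨Y, hY⟩ := hmk y hy0 hi hi'
    have : u = Y * act (σ.restrictScalars ℚ_[2]) Y := by
      apply hext
      rw [← hy, ← hY]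
      rfl
    rw [this, map_mul, hinvar]
    exact Int.units_mul_self _
  have hform : ∀ a b : IntermediateField.adjoin ℚ_[2] {ζ},
      ((a : M) + b * η) * σ (a + b * η) = (a : M) ^ 2 + 2 * (b : M) ^ 2 := by
    intro a b
    have ha : σ (a : M) = a := σ.commutes a
    have hb : σ (b : M) = b := σ.commutes b
    rw [map_add, map_mul, ha, hb, hση]
    linear_combination -(b : M) ^ 2 * hη
  intro u hu
  constructor
  · intro h1
    obtain ⟨a, b, h | h⟩ := unit_form ζ hζ.pow_eq_one _ (hne u) hu u.1.2
      (by rw [← hinv]; exact (u⁻¹).1.2)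
    · refine ⟨a + b * η, ?_, ?_⟩
      · intro h0
        have := hform a b
        rw [h0, zero_mul, ← h] at this
        exact hne u this.symm
      · rw [hσ, hform, h]
    · exfalso
      have hc1 : χ (c⁻¹ * u) = 1 := by
        apply hnorm _ (a + b * η)
        rw [hform]
        have h50 : (5 : M) ≠ 0 := hc ▸ hne c
        have : (((c⁻¹ * u : (integralClosure ℤ_[2] M)ˣ) : integralClosure ℤ_[2] M) : M) =
          (((c⁻¹ : (integralClosure ℤ_[2] M)ˣ) : integralClosure ℤ_[2] M) : M) *
            ((u : integralClosure ℤ_[2] M) : M) := rfl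
        rw [this, hinv, hc, h]
        field_simp
      rw [map_mul, map_inv, hχc, h1] at hc1
      exact absurd hc1 (by decide)
  · rintro ⟨y, -, hy⟩
    rw [hσ] at hy
    exact hnorm u y hy
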